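/- Let f be a univalent (injective holomorphic) function on the unit disk Δ. Then for every z ∈ Δ, (1/4)(1-|z|²)|f'(z)| ≤ dist(f(z), ∂f(Δ)) ≤ (1-|z|²)|f'(z)|. -/

import Mathlib

open Metric Set Filter Topology Complex ComplexConjugate MeasureTheory

/-- A holomorphic function which is locally injective at a point has nonzero derivative there. -/
theorem AnalyticAt.deriv_ne_zero_of_injOn {f : ℂ → ℂ} {z : ℂ} {s : Set ℂ} (hf : AnalyticAt ℂ f z)
    (hs : s ∈ 𝓝 z) (hinj : InjOn f s) : deriv f z ≠ 0 := by
  have hF : AnalyticAt ℂ (fun w ↦ f w - f z) z := hf.sub analyticAt_const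
  have hne : ¬ ∀ᶠ w in 𝓝 z, f w - f z = 0 := by
    intro h
    have h1 : ∀ᶠ w in 𝓝[≠] z, w ∈ s ∧ f w - f z = 0 :=
      ((eventually_mem_set.2 hs).and h).filter_mono nhdsWithin_le_nhds
    obtain ⟨w, ⟨hws, hw⟩, hwz⟩ := (h1.and eventually_mem_nhdsWithin).exists
    exact hwz (hinj hws (mem_of_mem_nhds hs) (sub_eq_zero.1 hw))
  obtain ⟨n, g, hg, hgz, hfg⟩ := hF.exists_eventuallyEq_pow_smul_nonzero_iff.2 hne
  have hn0 : n ≠ 0 := by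
    rintro rfl
    have := hfg.self_of_nhds
    simp at this
    exact hgz this.symm
  have hnC : (n : ℂ) ≠ 0 := by exact_mod_cast hn0
  set ψ : ℂ → ℂ := fun w ↦ (w - z) * (g w / g z) ^ (1 / n : ℂ) with hψ
  have hroot : AnalyticAt ℂ (fun w ↦ (g w / g z) ^ (1 / n : ℂ)) z :=
    (hg.div analyticAt_const hgz).cpow analyticAt_const (by simp [hgz])
  have hψa : AnalyticAt ℂ ψ z := (analyticAt_id.sub analyticAt_const).mul hroot
  have hψd : HasDerivAt ψ 1 z := by
    have h := ((hasDerivAt_id z).sub_const z).mul hroot.differentiableAt.hasDerivAt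
    convert! h using 1
    simp [hgz]
  have hψs : HasStrictDerivAt ψ 1 z := by
    have := hψa.hasStrictDerivAt
    rwa [hψd.deriv] at this
  have hmap : map ψ (𝓝 z) = 𝓝 0 := by
    have := hψs.map_nhds_eq one_ne_zero
    simpa [hψ] using this
  have hpow : ∀ᶠ w in 𝓝 z, f w = f z + g z * ψ w ^ n := by
    filter_upwards [hfg] with w hw
    have : ((g w / g z) ^ (1 / n : ℂ)) ^ n = g w / g z := by
      rw [← cpow_mul_nat, one_div, inv_mul_cancel₀ hnC, cpow_one]
    simp only [hψ, mul_pow, this]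
    rw [sub_eq_iff_eq_add.1 hw, smul_eq_mul]
    field_simp
    ring
  set T : Set ℂ := {w | w ∈ s ∧ f w = f z + g z * ψ w ^ n} with hT
  have hTz : T ∈ 𝓝 z := (eventually_mem_set.2 hs).and hpow
  have hψT : ψ '' T ∈ 𝓝 (0 : ℂ) := by
    rw [← hmap]
    exact image_mem_map hTz
  have hprim := Complex.isPrimitiveRoot_exp n hn0
  set ω := Complex.exp (2 * Real.pi * I / n) with hω
  have hωT : ∀ᶠ t in 𝓝 (0 : ℂ), ω * t ∈ ψ '' T := by
    have : Tendsto (fun t : ℂ ↦ ω * t) (𝓝 0) (𝓝 0) := by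
      have : Continuous (fun t : ℂ ↦ ω * t) := by fun_prop
      simpa using this.tendsto 0
    exact this hψT
  obtain ⟨t, ⟨⟨w₁, ⟨hw₁s, hw₁⟩, hw₁t⟩, ⟨w₂, ⟨hw₂s, hw₂⟩, hw₂t⟩⟩, ht0⟩ :=
    (((eventually_mem_set.2 hψT).and hωT).filter_mono nhdsWithin_le_nhds |>.and
      (eventually_mem_nhdsWithin (a := (0 : ℂ)) (s := {0}ᶜ))).exists
  have heq : w₁ = w₂ := by
    apply hinj hw₁s hw₂s
    rw [hw₁, hw₂, hw₁t, hw₂t, mul_pow, hprim.pow_eq_one, one_mul]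
  have hω1 : ω = 1 := by
    have h : ω * t = 1 * t := by rw [← hw₂t, ← heq, hw₁t, one_mul]
    exact mul_right_cancel₀ ht0 h
  have hn1 : n = 1 := by
    have := hprim.pow_eq_one_iff_dvd 1
    rw [pow_one] at this
    exact Nat.dvd_one.1 (this.1 hω1)
  subst hn1
  have hfd : HasDerivAt f (g z) z := by
    have h : HasDerivAt (fun w ↦ f z + g z * ψ w ^ 1) (g z) z := by
      simpa using! (hψd.const_mul (g z)).const_add (f z)
    exact h.congr_of_eventuallyEq hpow
  rwa [hfd.deriv]

/-- If the image of the unit disc under a univalent function contains a ball around `f 0`, the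
radius of this ball is at most `‖f' 0‖`. -/
theorem le_norm_deriv_of_ball_subset_image {f : ℂ → ℂ} (hf : DifferentiableOn ℂ f (ball 0 1))
    (hinj : InjOn f (ball 0 1)) {d : ℝ} (hd : ball (f 0) d ⊆ f '' ball 0 1) :
    d ≤ ‖deriv f 0‖ := by
  rcases le_or_gt d 0 with hd0 | hd0
  · exact hd0.trans (norm_nonneg _)
  set G := Function.invFunOn f (ball 0 1)
  have hG : ∀ z ∈ ball (0 : ℂ) 1, G (f z) = z := fun z hz ↦ hinj.leftInvOn_invFunOn hz
  have hGd : ∀ z ∈ ball (0 : ℂ) 1, HasDerivAt G (deriv f z)⁻¹ (f z) := by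
    intro z hz
    have hzn : ball (0 : ℂ) 1 ∈ 𝓝 z := isOpen_ball.mem_nhds hz
    have hfa : AnalyticAt ℂ f z := hf.analyticAt hzn
    refine (hfa.hasStrictDerivAt.to_local_left_inverse
      (hfa.deriv_ne_zero_of_injOn hzn hinj) ?_).hasDerivAt
    filter_upwards [hzn] using hG
  have h0 : (0 : ℂ) ∈ ball (0 : ℂ) 1 := by simp
  have key : ‖deriv G (f 0)‖ ≤ 1 / d := by
    apply norm_deriv_le_div_of_mapsTo_ball _ _ hd0
    · intro w hw
      obtain ⟨z, hz, rfl⟩ := hd hw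
      exact (hGd z hz).differentiableAt.differentiableWithinAt
    · intro w hw
      obtain ⟨z, hz, rfl⟩ := hd hw
      rw [hG z hz, hG 0 h0]
      exact ball_subset_closedBall hz
  have hne : 0 < ‖deriv f 0‖ := norm_pos_iff.2 <|
    (hf.analyticAt (isOpen_ball.mem_nhds h0)).deriv_ne_zero_of_injOn (isOpen_ball.mem_nhds h0) hinj
  rw [(hGd 0 h0).deriv, norm_inv, inv_eq_one_div] at key
  rwa [one_div_le_one_div hne hd0] at key

/-- A nonvanishing holomorphic function on the unit disc with value `1` at the origin has a
holomorphic square root with value `1` at the origin. -/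
theorem exists_differentiableOn_sq_eq {q : ℂ → ℂ} (hq : DifferentiableOn ℂ q (ball 0 1))
    (hq0 : ∀ z ∈ ball (0 : ℂ) 1, q z ≠ 0) (h1 : q 0 = 1) :
    ∃ s : ℂ → ℂ, DifferentiableOn ℂ s (ball 0 1) ∧ s 0 = 1 ∧ ∀ z ∈ ball (0 : ℂ) 1,
      s z ^ 2 = q z := by
  have hq' : DifferentiableOn ℂ (fun z ↦ deriv q z / q z) (ball 0 1) :=
    (hq.deriv isOpen_ball).div hq hq0
  obtain ⟨p, hp0, hp⟩ := hq'.isExactOn_ball.with_val_at 0 0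
  have hconst : ∀ z ∈ ball (0 : ℂ) 1, q z * exp (-p z) = q 0 * exp (-p 0) := by
    intro z hz
    have hd : ∀ w ∈ ball (0 : ℂ) 1, HasDerivAt (fun w ↦ q w * exp (-p w)) 0 w := by
      intro w hw
      have h1 := (hq.differentiableAt (isOpen_ball.mem_nhds hw)).hasDerivAt
      convert! h1.mul ((hp w hw).neg.cexp) using 1
      have := hq0 w hw
      simp only [Pi.neg_apply]
      field_simp
      ring
    exact isOpen_ball.is_const_of_deriv_eq_zero (convex_ball (0 : ℂ) 1).isPreconnected
      (fun w hw ↦ (hd w hw).differentiableAt.differentiableWithinAt)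
      (fun w hw ↦ (hd w hw).deriv) hz (by simp)
  refine ⟨fun z ↦ exp (p z / 2), fun z hz ↦
    ((hp z hz).div_const 2).cexp.differentiableAt.differentiableWithinAt, by simp [hp0], ?_⟩
  intro z hz
  have h := hconst z hz
  rw [h1, hp0, neg_zero, exp_zero, mul_one, exp_neg] at h
  rw [← exp_nat_mul]
  have h2 : ((2 : ℕ) : ℂ) * (p z / 2) = p z := by push_cast; ring
  rw [h2]
  exact ((mul_inv_eq_one₀ (exp_ne_zero _)).1 h).symm
/-- A half-plane containing the image of the circle of radius `ε` under an injective function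
`ζ⁻¹ + h ζ` also contains the image of the exterior of this circle. -/
theorem re_le_of_forall_sphere_re_le {h : ℂ → ℂ} (hh : DifferentiableOn ℂ h (ball 0 1))
    (hinj : InjOn (fun ζ ↦ ζ⁻¹ + h ζ) (ball 0 1 \ {0})) {ε : ℝ} (hε : 0 < ε) (hε1 : ε < 1)
    {β : ℂ} {m : ℝ} (hm : ∀ ζ ∈ sphere (0 : ℂ) ε, (β * (ζ⁻¹ + h ζ)).re ≤ m)
    {ζ₀ : ℂ} (h₀ : ε < ‖ζ₀‖) (h₁ : ‖ζ₀‖ < 1) : (β * (ζ₀⁻¹ + h ζ₀)).re ≤ m := by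
  by_contra! hcon
  set w₀ := ζ₀⁻¹ + h ζ₀ with hw₀
  have hsub : closedBall (0 : ℂ) ε ⊆ ball 0 1 := closedBall_subset_ball hε1
  set D : ℂ → ℂ := fun ζ ↦ 1 + ζ * h ζ - w₀ * ζ with hD
  have hD0 : ∀ ζ ∈ closedBall (0 : ℂ) ε, D ζ ≠ 0 := by
    intro ζ hζ hz
    have hζ0 : ζ ≠ 0 := by
      rintro rfl
      simp [hD] at hz
    have heq : ζ⁻¹ + h ζ = w₀ := by
      have hz' : 1 + ζ * h ζ - w₀ * ζ = 0 := hz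
      field_simp
      linear_combination hz'
    have hne0 : ζ₀ ≠ 0 := norm_pos_iff.1 (hε.trans h₀)
    have := hinj ⟨hsub hζ, hζ0⟩ ⟨by simpa using h₁, hne0⟩ heq
    rw [this, mem_closedBall_zero_iff] at hζ
    exact absurd hζ (not_le.2 h₀)
  set φ : ℂ → ℂ := fun ζ ↦ β⁻¹ * (ζ * (D ζ)⁻¹) with hφ
  have hDd : DifferentiableOn ℂ D (closedBall 0 ε) := by
    have := hh.mono hsub
    fun_prop
  have hφd : DifferentiableOn ℂ φ (closedBall 0 ε) :=
    (differentiableOn_id.mul (hDd.inv hD0)).const_mul _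
  have hneg : ∀ ζ ∈ sphere (0 : ℂ) ε, (φ ζ).re < 0 := by
    intro ζ hζ
    have hζ0 : ζ ≠ 0 := by
      rintro rfl
      simp at hζ
      exact hε.ne hζ
    have hre : (β * (ζ⁻¹ + h ζ - w₀)).re < 0 := by
      have := hm ζ hζ
      rw [mul_sub, sub_re]
      linarith
    have hφζ : φ ζ = (β * (ζ⁻¹ + h ζ - w₀))⁻¹ := by
      have : ζ⁻¹ + h ζ - w₀ = ζ⁻¹ * D ζ := by
        simp only [hD]
        field_simp
      rw [this, mul_inv, mul_inv, inv_inv]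
    rw [hφζ, inv_re]
    refine div_neg_of_neg_of_pos hre (normSq_pos.2 ?_)
    intro h0
    simp [h0] at hre
  obtain ⟨ζ₁, hζ₁, hmax⟩ := (isCompact_sphere (0 : ℂ) ε).exists_isMaxOn
    (NormedSpace.sphere_nonempty.2 hε.le)
    (continuous_re.comp_continuousOn (hφd.continuousOn.mono sphere_subset_closedBall))
  have hle : ‖exp (φ 0)‖ ≤ Real.exp (φ ζ₁).re := by
    refine norm_le_of_forall_mem_frontier_norm_le (f := fun ζ ↦ exp (φ ζ)) (U := ball 0 ε)
      isBounded_ball ?_ ?_ (subset_closure (by simpa using hε))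
    · refine DifferentiableOn.diffContOnCl ?_
      rw [closure_ball _ hε.ne']
      exact hφd.cexp
    · intro ζ hζ
      rw [frontier_ball _ hε.ne'] at hζ
      rw [norm_exp]
      exact Real.exp_le_exp.2 (hmax hζ)
  have hφ0 : φ 0 = 0 := by simp [hφ]
  rw [norm_exp, Real.exp_le_exp, hφ0, zero_re] at hle
  exact absurd hle (not_le.2 (hneg ζ₁ hζ₁))

/-- An ellipse containing the image of the circle of radius `ε` under an injective function
`ζ⁻¹ + h ζ` also contains the image of the exterior of this circle. -/
theorem norm_sub_mul_conj_le_of_forall_sphere {h : ℂ → ℂ} (hh : DifferentiableOn ℂ h (ball 0 1))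
    (hinj : InjOn (fun ζ ↦ ζ⁻¹ + h ζ) (ball 0 1 \ {0})) {ε : ℝ} (hε : 0 < ε) (hε1 : ε < 1)
    {a : ℂ} {m : ℝ}
    (hm : ∀ ζ ∈ sphere (0 : ℂ) ε, ‖(ζ⁻¹ + h ζ) - a * conj (ζ⁻¹ + h ζ)‖ ≤ m)
    {ζ₀ : ℂ} (h₀ : ε < ‖ζ₀‖) (h₁ : ‖ζ₀‖ < 1) :
    ‖(ζ₀⁻¹ + h ζ₀) - a * conj (ζ₀⁻¹ + h ζ₀)‖ ≤ m := by
  have hfun : ∀ u w : ℂ, (conj u * (w - a * conj w)).re = ((conj u - u * conj a) * w).re := by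
    intro u w
    simp
    ring
  set L₀ := (ζ₀⁻¹ + h ζ₀) - a * conj (ζ₀⁻¹ + h ζ₀) with hL₀
  have key := re_le_of_forall_sphere_re_le hh hinj hε hε1 (β := conj L₀ - L₀ * conj a)
    (m := ‖L₀‖ * m) (fun ζ hζ ↦ by
      rw [← hfun]
      refine (re_le_norm _).trans ?_
      rw [norm_mul, norm_conj]
      exact mul_le_mul_of_nonneg_left (hm ζ hζ) (norm_nonneg _)) h₀ h₁
  rw [← hfun, ← hL₀, ← normSq_eq_conj_mul_self, ofReal_re, normSq_eq_norm_sq] at key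
  have hm0 : 0 ≤ m := by
    obtain ⟨ζ, hζ⟩ := (NormedSpace.sphere_nonempty (x := (0 : ℂ))).2 hε.le
    exact (norm_nonneg _).trans (hm ζ hζ)
  rcases (norm_nonneg L₀).eq_or_lt with h | h
  · rwa [← h]
  · exact le_of_mul_le_mul_left (by rwa [← sq]) h

theorem det_smul_sub_conj (a : ℂ) :
    LinearMap.det ((LinearMap.id : ℂ →ₗ[ℝ] ℂ) -
      (LinearMap.mulLeft ℝ a).comp conjAe.toLinearMap) = 1 - ‖a‖ ^ 2 := by
  rw [← LinearMap.det_toMatrix basisOneI, Matrix.det_fin_two]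
  simp [LinearMap.toMatrix_apply, ← normSq_eq_norm_sq, normSq_apply]
  ring

theorem volume_setOf_norm_sub_mul_conj_le {a : ℂ} (ha : ‖a‖ < 1) {m : ℝ} (hm : 0 ≤ m) :
    volume {w : ℂ | ‖w - a * conj w‖ ≤ m} = ENNReal.ofReal (Real.pi * m ^ 2 / (1 - ‖a‖ ^ 2)) := by
  have hpos : 0 < 1 - ‖a‖ ^ 2 := by
    have := norm_nonneg a
    nlinarith
  have hdet := det_smul_sub_conj a
  have := Measure.addHaar_preimage_linearMap (volume : Measure ℂ) (f := (LinearMap.id : ℂ →ₗ[ℝ] ℂ) -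
      (LinearMap.mulLeft ℝ a).comp conjAe.toLinearMap) (by rw [hdet]; exact hpos.ne')
      (closedBall 0 m)
  rw [hdet, Complex.volume_closedBall, abs_of_pos (inv_pos.2 hpos)] at this
  convert this using 1
  · congr 1
    ext w
    simp
  · rw [← ENNReal.ofReal_pow hm, ← ENNReal.ofReal_coe_nnreal, NNReal.coe_real_pi,
      ← ENNReal.ofReal_mul (by positivity), ← ENNReal.ofReal_mul (by positivity)]
    congr 1
    field_simp

/-- The area formula for injective holomorphic functions. -/
theorem lintegral_norm_deriv_sq_eq_volume_image {F F' : ℂ → ℂ} {A : Set ℂ} (hA : MeasurableSet A)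
    (hF : ∀ z ∈ A, HasDerivAt F (F' z) z) (hinj : InjOn F A) :
    ∫⁻ z in A, ENNReal.ofReal (‖F' z‖ ^ 2) = volume (F '' A) := by
  rw [← lintegral_abs_det_fderiv_eq_addHaar_image volume hA
    (fun z hz ↦ ((hF z hz).hasFDerivAt.restrictScalars ℝ).hasFDerivWithinAt) hinj]
  refine lintegral_congr fun z ↦ ?_
  simp [ContinuousLinearMap.det, LinearMap.det_restrictScalars,
      Algebra.norm_complex_eq, Complex.normSq_eq_norm_sq]
theorem integral_neg_pi_pi_circleMap (g : ℂ → ℝ) (r : ℝ) :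
    ∫ θ in Ioo (-Real.pi) Real.pi, g (circleMap 0 r θ) =
      2 * Real.pi * Real.circleAverage g 0 r := by
  rw [Real.circleAverage_eq_integral_add (-Real.pi),
    intervalIntegral.integral_comp_add_right (fun θ ↦ g (circleMap 0 r θ)),
    ← integral_Ioc_eq_integral_Ioo, ← intervalIntegral.integral_of_le (by linarith [Real.pi_pos]),
    smul_eq_mul, ← mul_assoc, mul_inv_cancel₀ (by positivity), one_mul]
  congr 1 <;> ring

/-- Integration over an annulus in polar coordinates, with a lower bound for the averages over
circles. -/
theorem ofReal_integral_le_lintegral_annulus {g : ℂ → ℝ} {c : ℝ → ℝ} {ε ρ : ℝ} (hε : 0 < ε)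
    (hg0 : ∀ z, 0 ≤ g z) (hg : ContinuousOn g (ball 0 ρ \ closedBall 0 ε))
    (hc : ContinuousOn c (Icc ε ρ)) (hc0 : ∀ r ∈ Ioo ε ρ, 0 ≤ c r)
    (hcg : ∀ r ∈ Ioo ε ρ, c r ≤ Real.circleAverage g 0 r) :
    ENNReal.ofReal (∫ r in Ioo ε ρ, r * (2 * Real.pi * c r)) ≤
      ∫⁻ z in ball 0 ρ \ closedBall 0 ε, ENNReal.ofReal (g z) := by
  classical
  set A : Set ℂ := ball 0 ρ \ closedBall 0 ε with hA
  have hAm : MeasurableSet A := measurableSet_ball.diff measurableSet_closedBall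
  have hmeas : Measurable (A.indicator fun z ↦ ENNReal.ofReal (g z)) := by
    have h1 : Measurable (A.indicator g) := by
      rw [← piecewise_eq_indicator]
      exact hg.measurable_piecewise continuousOn_const hAm
    have h2 : (A.indicator fun z ↦ ENNReal.ofReal (g z)) =
        fun z ↦ ENNReal.ofReal (A.indicator g z) := by
      ext z
      by_cases hz : z ∈ A <;> simp [hz]
    rw [h2]
    exact h1.ennreal_ofReal
  have hpolar : ∀ p : ℝ × ℝ, Complex.polarCoord.symm p = circleMap 0 p.1 p.2 := by
    intro p
    rw [Complex.polarCoord_symm_apply, circleMap, zero_add, exp_mul_I, ofReal_cos, ofReal_sin]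
  have hcirc : Continuous fun p : ℝ × ℝ ↦ circleMap 0 p.1 p.2 := by fun_prop
  have hmem : ∀ r ∈ Ioo ε ρ, ∀ θ : ℝ, circleMap 0 r θ ∈ A := by
    intro r hr θ
    have : ‖circleMap 0 r θ‖ = r := by simp [abs_of_pos (hε.trans hr.1)]
    simp only [hA, Set.mem_sdiff, mem_ball_zero_iff, mem_closedBall_zero_iff, this, not_le]
    exact ⟨hr.2, hr.1⟩
  have hcint : ContinuousOn (fun r ↦ r * (2 * Real.pi * c r)) (Icc ε ρ) := by fun_prop
  calc
    ENNReal.ofReal (∫ r in Ioo ε ρ, r * (2 * Real.pi * c r))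
      = ∫⁻ r in Ioo ε ρ, ENNReal.ofReal (r * (2 * Real.pi * c r)) := by
        refine ofReal_integral_eq_lintegral_ofReal
          (hcint.integrableOn_Icc.mono_set Ioo_subset_Icc_self) ?_
        refine (ae_restrict_iff' measurableSet_Ioo).2 (.of_forall fun r hr ↦ ?_)
        have := hc0 r hr
        have := hε.trans hr.1
        have := Real.pi_pos
        change 0 ≤ _
        positivity
    _ ≤ ∫⁻ r in Ioo ε ρ, ∫⁻ θ in Ioo (-Real.pi) Real.pi, ENNReal.ofReal r *
          A.indicator (fun z ↦ ENNReal.ofReal (g z)) (circleMap 0 r θ) := by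
        refine setLIntegral_mono' measurableSet_Ioo fun r hr ↦ ?_
        have hr0 := hε.trans hr.1
        have hcont : Continuous fun θ ↦ g (circleMap 0 r θ) :=
          hg.comp_continuous (continuous_circleMap 0 r) (hmem r hr)
        rw [lintegral_const_mul' _ _ ENNReal.ofReal_ne_top, ENNReal.ofReal_mul hr0.le]
        gcongr
        simp only [indicator_of_mem (hmem r hr _)]
        rw [← ofReal_integral_eq_lintegral_ofReal
          ((hcont.integrableOn_Icc).mono_set Ioo_subset_Icc_self) (.of_forall fun θ ↦ hg0 _),
          integral_neg_pi_pi_circleMap]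
        gcongr
        exact hcg r hr
    _ ≤ ∫⁻ r in Ioi 0, ∫⁻ θ in Ioo (-Real.pi) Real.pi, ENNReal.ofReal r *
          A.indicator (fun z ↦ ENNReal.ofReal (g z)) (circleMap 0 r θ) :=
        lintegral_mono_set fun r hr ↦ hε.trans hr.1
    _ = ∫⁻ p in polarCoord.target, ENNReal.ofReal p.1 •
          A.indicator (fun z ↦ ENNReal.ofReal (g z)) (Complex.polarCoord.symm p) := by
        simp only [polarCoord_target, hpolar, smul_eq_mul]
        rw [Measure.volume_eq_prod, ← Measure.prod_restrict, lintegral_prod]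
        exact ((ENNReal.measurable_ofReal.comp measurable_fst).mul
          (hmeas.comp hcirc.measurable)).aemeasurable
    _ = ∫⁻ z in A, ENNReal.ofReal (g z) := by
        rw [Complex.lintegral_comp_polarCoord_symm, lintegral_indicator hAm]

theorem le_circleAverage_norm_sub_sq {k : ℂ → ℂ} (hk : DifferentiableOn ℂ k (ball 0 1)) {r : ℝ}
    (hr : 0 < r) (hr1 : r < 1) :
    r⁻¹ ^ 4 + ‖k 0‖ ^ 2 ≤ Real.circleAverage (fun z ↦ ‖k z - (z ^ 2)⁻¹‖ ^ 2) 0 r := by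
  set b := k 0 with hb
  set ψ : ℂ → ℂ := fun z ↦ ((r⁻¹ ^ 4 + ‖b‖ ^ 2 : ℝ) : ℂ) - 2 * (r⁻¹ ^ 4 : ℝ) * (z ^ 2 * k z) +
    2 * conj b * (k z - b) with hψ
  have hkc : DifferentiableOn ℂ k (closedBall 0 r) := hk.mono (closedBall_subset_ball hr1)
  have hψd : DifferentiableOn ℂ ψ (closedBall 0 r) := by fun_prop
  have hsph : sphere (0 : ℂ) |r| ⊆ closedBall 0 r := by
    rw [abs_of_pos hr]
    exact sphere_subset_closedBall
  have hψi : CircleIntegrable ψ 0 r :=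
    (hψd.continuousOn.mono hsph).circleIntegrable'
  have havg : Real.circleAverage ψ 0 r = ψ 0 := by
    refine DiffContOnCl.circleAverage (DifferentiableOn.diffContOnCl ?_)
    rw [abs_of_pos hr, closure_ball _ hr.ne']
    exact hψd
  have hre : Real.circleAverage (fun z ↦ (ψ z).re) 0 r = r⁻¹ ^ 4 + ‖b‖ ^ 2 := by
    have := reCLM.circleAverage_comp_comm hψi
    rw [havg] at this
    simp [hψ, ← hb, -ofReal_add, -ofReal_pow, -ofReal_inv] at this
    simpa [hψ, Function.comp_def] using this
  rw [← hre]
  have hz0 : ∀ z ∈ sphere (0 : ℂ) |r|, z ≠ 0 := by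
    rintro z hz rfl
    simp at hz
    exact hr.ne' (abs_eq_zero.1 hz.symm)
  refine Real.circleAverage_mono ?_ ?_ ?_
  · exact (continuous_re.comp_continuousOn (hψd.continuousOn.mono hsph)).circleIntegrable'
  · refine ContinuousOn.circleIntegrable' ?_
    exact (((hkc.continuousOn.mono hsph).sub
      ((continuousOn_id.pow 2).inv₀ fun z hz ↦ pow_ne_zero 2 (hz0 z hz))).norm).pow 2
  · intro z hz
    have hzne := hz0 z hz
    have hzr : ‖z‖ = r := by simpa [abs_of_pos hr] using hz
    have h1 : (z ^ 2)⁻¹ = (r⁻¹ ^ 4 : ℝ) * conj (z ^ 2) := by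
      have : z * conj z = (r : ℂ) ^ 2 := by rw [mul_conj, normSq_eq_norm_sq, hzr]; push_cast; rfl
      have hrC : (r : ℂ) ≠ 0 := by exact_mod_cast hr.ne'
      push_cast
      rw [map_pow]
      field_simp
      linear_combination -(z * conj z + r ^ 2) * this
    have h2 : ‖k z - (z ^ 2)⁻¹‖ ^ 2 = ‖k z‖ ^ 2 + r⁻¹ ^ 4 - 2 * r⁻¹ ^ 4 * (z ^ 2 * k z).re := by
      rw [← normSq_eq_norm_sq, normSq_sub, normSq_eq_norm_sq, normSq_eq_norm_sq, norm_inv, norm_pow,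
        hzr, h1, map_mul, conj_ofReal, conj_conj]
      have : k z * ((r⁻¹ ^ 4 : ℝ) * z ^ 2) = (r⁻¹ ^ 4 : ℝ) * (z ^ 2 * k z) := by ring
      rw [this, re_ofReal_mul]
      ring
    have h3 : (ψ z).re = r⁻¹ ^ 4 + ‖b‖ ^ 2 - 2 * r⁻¹ ^ 4 * (z ^ 2 * k z).re +
        2 * (conj b * (k z - b)).re := by
      have : ψ z = ((r⁻¹ ^ 4 + ‖b‖ ^ 2 : ℝ) : ℂ) - ((2 * r⁻¹ ^ 4 : ℝ) : ℂ) * (z ^ 2 * k z) +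
        ((2 : ℝ) : ℂ) * (conj b * (k z - b)) := by
        simp only [hψ]
        push_cast
        ring
      rw [this, add_re, sub_re, ofReal_re, re_ofReal_mul, re_ofReal_mul]
    have h4 : ‖b‖ ^ 2 + 2 * (conj b * (k z - b)).re ≤ ‖k z‖ ^ 2 := by
      have h := sq_nonneg ‖k z - b‖
      rw [← normSq_eq_norm_sq, normSq_apply] at h
      rw [← normSq_eq_norm_sq, ← normSq_eq_norm_sq, normSq_apply, normSq_apply]
      simp at h ⊢
      linarith
    rw [h2, h3]
    linarith

/-- **Area theorem**, first coefficient: if `ζ⁻¹ + ζ * t ζ` is injective on the punctured unit disc,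
then `‖t 0‖ ≤ 1`. -/
theorem norm_le_one_of_injOn_inv_add_mul {t : ℂ → ℂ} (ht : DifferentiableOn ℂ t (ball 0 1))
    (hinj : InjOn (fun ζ ↦ ζ⁻¹ + ζ * t ζ) (ball 0 1 \ {0})) : ‖t 0‖ ≤ 1 := by
  set b := t 0 with hb
  set B := ‖b‖ ^ 2 with hB
  have h01 : ball (0 : ℂ) 1 ∈ 𝓝 0 := isOpen_ball.mem_nhds (by simp)
  have hh : DifferentiableOn ℂ (fun ζ ↦ ζ * t ζ) (ball 0 1) := differentiableOn_id.mul ht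
  obtain ⟨K, hK0, hK⟩ :=
    (ht.differentiableAt h01).hasDerivAt.differentiableAt.isBigO_sub.exists_pos
  obtain ⟨δ, hδ, hKδ⟩ := Metric.eventually_nhds_iff_ball.1 hK.bound
  set C := K + ‖b‖ * (‖b‖ + K) with hC
  have hC0 : 0 < C := by positivity
  have hcircle : ∀ ε : ℝ, 0 < ε → ε < 1 → ε < δ → ∀ ζ ∈ sphere (0 : ℂ) ε,
      ‖(ζ⁻¹ + ζ * t ζ) - (b * ε ^ 2) * conj (ζ⁻¹ + ζ * t ζ)‖ ≤ ε⁻¹ + C * ε ^ 2 := by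
    intro ε hε hε1 hεδ ζ hζ
    have hζn : ‖ζ‖ = ε := by simpa using hζ
    have hζ0 : ζ ≠ 0 := norm_pos_iff.1 (hζn ▸ hε)
    have hsq : ζ * conj ζ = (ε : ℂ) ^ 2 := by
      rw [mul_conj, normSq_eq_norm_sq, hζn]
      push_cast
      rfl
    have hcζ : conj ζ ≠ 0 := (map_ne_zero _).2 hζ0
    have hdecomp : (ζ⁻¹ + ζ * t ζ) - (b * ε ^ 2) * conj (ζ⁻¹ + ζ * t ζ) =
        ζ⁻¹ + ζ * (t ζ - b) - (b * ε ^ 2) * (conj ζ * conj (t ζ)) := by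
      rw [map_add, map_mul, map_inv₀, ← hsq]
      field_simp
      ring
    have h1 : ‖t ζ - b‖ ≤ K * ε := by
      have := hKδ ζ (by simpa [hζn] using hεδ)
      rwa [sub_zero, hζn] at this
    have h2 : ‖t ζ‖ ≤ ‖b‖ + K := by
      calc ‖t ζ‖ = ‖b + (t ζ - b)‖ := by ring_nf
        _ ≤ ‖b‖ + ‖t ζ - b‖ := norm_add_le _ _
        _ ≤ ‖b‖ + K := by
          gcongr
          exact h1.trans (mul_le_of_le_one_right hK0.le hε1.le)
    rw [hdecomp]
    calc _ ≤ ‖ζ⁻¹‖ + ‖ζ * (t ζ - b)‖ + ‖(b * ε ^ 2) * (conj ζ * conj (t ζ))‖ :=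
          (norm_sub_le _ _).trans (by gcongr; exact norm_add_le _ _)
      _ = ε⁻¹ + ε * ‖t ζ - b‖ + (‖b‖ * ε ^ 2) * (ε * ‖t ζ‖) := by
          simp [hζn, abs_of_pos hε]
      _ ≤ ε⁻¹ + ε * (K * ε) + (‖b‖ * ε ^ 2) * (1 * (‖b‖ + K)) := by gcongr
      _ = ε⁻¹ + C * ε ^ 2 := by rw [hC]; ring
  have harea : ∀ ρ : ℝ, ρ < 1 → ∀ ε : ℝ, 0 < ε → ε < ρ → ε < δ → ‖b‖ * ε ^ 2 < 1 →
      -ρ⁻¹ ^ 2 + B * (ρ ^ 2 - ε ^ 2) - B * ε ^ 2 - (-ρ⁻¹ ^ 2 + B * (ρ ^ 2 - ε ^ 2)) * B * ε ^ 4 ≤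
        2 * C * ε + C ^ 2 * ε ^ 4 := by
    intro ρ hρ1 ε hε hερ hεδ hbε
    have hρ0 := hε.trans hερ
    have hε1 := hερ.trans hρ1
    set k := deriv fun ζ ↦ ζ * t ζ with hk
    have hk0 : k 0 = b := by
      have := (hasDerivAt_id (0 : ℂ)).mul (ht.differentiableAt h01).hasDerivAt
      rw [hk]
      simpa using! this.deriv
    have hkd : DifferentiableOn ℂ k (ball 0 1) := hh.deriv isOpen_ball
    set A : Set ℂ := ball 0 ρ \ closedBall 0 ε with hA
    have hA0 : ∀ z ∈ A, z ≠ 0 := by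
      rintro z hz rfl
      exact hz.2 (by simpa using hε.le)
    have hA1 : A ⊆ ball 0 1 := sdiff_subset.trans (ball_subset_ball hρ1.le)
    have hder : ∀ z ∈ A, HasDerivAt (fun ζ ↦ ζ⁻¹ + ζ * t ζ) (k z - (z ^ 2)⁻¹) z := by
      intro z hz
      have h1 := hasDerivAt_inv (hA0 z hz)
      have h2 := (hh.differentiableAt (isOpen_ball.mem_nhds (hA1 hz))).hasDerivAt
      convert! h1.add h2 using 1
      ring
    have hAm : MeasurableSet A := measurableSet_ball.diff measurableSet_closedBall
    have hA10 : A ⊆ ball 0 1 \ {0} := fun z hz ↦ ⟨hA1 hz, hA0 z hz⟩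
    have hvol := lintegral_norm_deriv_sq_eq_volume_image hAm hder (hinj.mono hA10)
    have hlow := ofReal_integral_le_lintegral_annulus (g := fun z ↦ ‖k z - (z ^ 2)⁻¹‖ ^ 2)
      (c := fun r ↦ r⁻¹ ^ 4 + B) (ρ := ρ) hε (fun z ↦ by positivity)
      ((((hkd.continuousOn.mono hA1).sub ((continuousOn_id.pow 2).inv₀
        fun z hz ↦ pow_ne_zero 2 (hA0 z hz))).norm).pow 2)
      (((continuousOn_id.inv₀ fun r hr ↦ (hε.trans_le hr.1).ne').pow 4).add continuousOn_const)
      (fun r _ ↦ by positivity)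
      (fun r hr ↦ by
        rw [hB, ← hk0]
        exact le_circleAverage_norm_sub_sq hkd (hε.trans hr.1) (hr.2.trans hρ1))
    have hεC : ‖b * (ε : ℂ) ^ 2‖ = ‖b‖ * ε ^ 2 := by simp [abs_of_pos hε]
    have hup : volume ((fun ζ ↦ ζ⁻¹ + ζ * t ζ) '' A) ≤
        ENNReal.ofReal (Real.pi * (ε⁻¹ + C * ε ^ 2) ^ 2 / (1 - (‖b‖ * ε ^ 2) ^ 2)) := by
      rw [← hεC, ← volume_setOf_norm_sub_mul_conj_le (by rwa [hεC]) (by positivity)]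
      refine measure_mono ?_
      rintro _ ⟨z, hz, rfl⟩
      exact norm_sub_mul_conj_le_of_forall_sphere hh hinj hε hε1 (hcircle ε hε hε1 hεδ)
        (by simpa using hz.2) (by simpa using hA1 hz)
    have hint : ∫ r in Ioo ε ρ, r * (2 * Real.pi * (r⁻¹ ^ 4 + B)) =
        Real.pi * (ε⁻¹ ^ 2 - ρ⁻¹ ^ 2 + B * (ρ ^ 2 - ε ^ 2)) := by
      rw [← integral_Ioc_eq_integral_Ioo, ← intervalIntegral.integral_of_le hερ.le]
      have hpos : ∀ r ∈ uIcc ε ρ, r ≠ 0 := by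
        intro r hr
        rw [uIcc_of_le hερ.le] at hr
        exact (hε.trans_le hr.1).ne'
      rw [intervalIntegral.integral_eq_sub_of_hasDerivAt
        (f := fun r ↦ Real.pi * (-r⁻¹ ^ 2 + B * r ^ 2))]
      · ring
      · intro r hr
        have hr0 := hpos r hr
        convert! (((hasDerivAt_inv hr0).pow 2).neg.add ((hasDerivAt_pow 2 r).const_mul B)).const_mul
          Real.pi using 1
        simp
        field_simp
      · refine ContinuousOn.intervalIntegrable ?_
        exact continuousOn_id.mul (continuousOn_const.mul
          (((continuousOn_id.inv₀ hpos).pow 4).add continuousOn_const))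
    rw [hvol, hint] at hlow
    have hd : 0 < 1 - (‖b‖ * ε ^ 2) ^ 2 := by
      have : 0 ≤ ‖b‖ * ε ^ 2 := by positivity
      nlinarith
    have hfin := (ENNReal.ofReal_le_ofReal_iff (by positivity)).1 (hlow.trans hup)
    rw [mul_div_assoc] at hfin
    have hfin' := le_of_mul_le_mul_left hfin Real.pi_pos
    rw [le_div_iff₀ hd] at hfin'
    have e1 : ε⁻¹ ^ 2 * ε ^ 4 = ε ^ 2 := by field_simp
    have e2 : ε⁻¹ * ε ^ 2 = ε := by field_simp
    have e3 : (‖b‖ * ε ^ 2) ^ 2 = B * ε ^ 4 := by rw [hB]; ring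
    rw [e3] at hfin'
    linear_combination hfin' + B * e1 + 2 * C * e2
  have hlim : ∀ ρ : ℝ, 0 < ρ → ρ < 1 → -ρ⁻¹ ^ 2 + B * ρ ^ 2 ≤ 0 := by
    intro ρ hρ0 hρ1
    have h1 : Tendsto (fun ε : ℝ ↦ -ρ⁻¹ ^ 2 + B * (ρ ^ 2 - ε ^ 2) - B * ε ^ 2 -
        (-ρ⁻¹ ^ 2 + B * (ρ ^ 2 - ε ^ 2)) * B * ε ^ 4) (𝓝[>] 0) (𝓝 (-ρ⁻¹ ^ 2 + B * ρ ^ 2)) := by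
      refine Continuous.tendsto' ?_ _ _ ?_ |>.mono_left nhdsWithin_le_nhds
      · fun_prop
      · simp
    have h2 : Tendsto (fun ε : ℝ ↦ 2 * C * ε + C ^ 2 * ε ^ 4) (𝓝[>] 0) (𝓝 0) := by
      refine Continuous.tendsto' ?_ _ _ ?_ |>.mono_left nhdsWithin_le_nhds
      · fun_prop
      · simp
    refine le_of_tendsto_of_tendsto h1 h2 ?_
    have h3 : ∀ᶠ ε : ℝ in 𝓝 0, ‖b‖ * ε ^ 2 < 1 := by
      have : Continuous fun ε : ℝ ↦ ‖b‖ * ε ^ 2 := by fun_prop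
      exact (this.tendsto' 0 0 (by simp)).eventually_lt_const one_pos
    filter_upwards [self_mem_nhdsWithin, nhdsWithin_le_nhds (Iio_mem_nhds hρ0),
      nhdsWithin_le_nhds (Iio_mem_nhds hδ), nhdsWithin_le_nhds h3] with ε h1 h2 h3 h4
    exact harea ρ hρ1 ε h1 h2 h3 h4
  have hB1 : B ≤ 1 := by
    have h1 : Tendsto (fun ρ : ℝ ↦ -ρ⁻¹ ^ 2 + B * ρ ^ 2) (𝓝[<] 1) (𝓝 (-1 + B)) := by
      have : ContinuousAt (fun ρ : ℝ ↦ -ρ⁻¹ ^ 2 + B * ρ ^ 2) 1 := by fun_prop (disch := norm_num)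
      have := this.tendsto
      simp only [inv_one, one_pow, mul_one] at this
      exact this.mono_left nhdsWithin_le_nhds
    have := le_of_tendsto h1 (b := 0) (by
      filter_upwards [self_mem_nhdsWithin, nhdsWithin_le_nhds (Ioi_mem_nhds one_pos)] with ρ h1 h2
      exact hlim ρ h2 h1)
    linarith
  exact (sq_le_one_iff₀ (norm_nonneg b)).1 hB1

/-- **Bieberbach's inequality**, in terms of reciprocals: if `q` is holomorphic and nonvanishing on
the unit disc, `q 0 = 1` and `q ζ / ζ` is injective, then `‖q' 0‖ ≤ 2`. -/
theorem norm_deriv_le_two_of_injOn_div {q : ℂ → ℂ} (hq : DifferentiableOn ℂ q (ball 0 1))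
    (hq0 : ∀ z ∈ ball (0 : ℂ) 1, q z ≠ 0) (h1 : q 0 = 1)
    (hinj : InjOn (fun ζ ↦ q ζ / ζ) (ball 0 1 \ {0})) : ‖deriv q 0‖ ≤ 2 := by
  obtain ⟨s, hs, hs0, hsq⟩ := exists_differentiableOn_sq_eq hq hq0 h1
  have h01 : ball (0 : ℂ) 1 ∈ 𝓝 0 := isOpen_ball.mem_nhds (by simp)
  have hsd := (hs.differentiableAt h01).hasDerivAt
  have hder : deriv q 0 = 2 * deriv s 0 := by
    have h : q =ᶠ[𝓝 0] fun z ↦ s z ^ 2 := by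
      filter_upwards [h01] with z hz using (hsq z hz).symm
    rw [h.deriv_eq, (hsd.fun_pow 2).deriv, hs0]
    simp
  have hmaps : MapsTo (fun z : ℂ ↦ z ^ 2) (ball 0 1) (ball 0 1) := by
    intro z hz
    simpa using pow_lt_one₀ (norm_nonneg z) (by simpa using hz) two_ne_zero
  have ht : DifferentiableOn ℂ (fun z ↦ dslope s 0 (z ^ 2)) (ball 0 1) :=
    ((differentiableOn_dslope h01).2 hs).comp (by fun_prop) hmaps
  have hF : ∀ z : ℂ, z ≠ 0 → z⁻¹ + z * dslope s 0 (z ^ 2) = s (z ^ 2) / z := by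
    intro z hz
    have := sub_smul_dslope s 0 (z ^ 2)
    rw [hs0, smul_eq_mul, sub_zero] at this
    field_simp
    linear_combination this
  have key := norm_le_one_of_injOn_inv_add_mul ht (by
    rintro x ⟨hx, hx0⟩ y ⟨hy, hy0⟩ hxy
    replace hx0 : x ≠ 0 := hx0
    replace hy0 : y ≠ 0 := hy0
    simp only [hF x hx0, hF y hy0] at hxy
    have hx2 := hmaps hx
    have hy2 := hmaps hy
    have hsqeq : x ^ 2 = y ^ 2 := by
      refine hinj ⟨hx2, pow_ne_zero 2 hx0⟩ ⟨hy2, pow_ne_zero 2 hy0⟩ ?_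
      simp only
      rw [← hsq _ hx2, ← hsq _ hy2, ← div_pow, ← div_pow, hxy]
    rcases sq_eq_sq_iff_eq_or_eq_neg.1 hsqeq with h | h
    · exact h
    · exfalso
      have hsne : s (y ^ 2) ≠ 0 := fun h0 ↦ hq0 _ hy2 (by rw [← hsq _ hy2, h0]; simp)
      rw [h, neg_sq] at hxy
      field_simp at hxy
      norm_num at hxy)
  simp only [ne_eq, OfNat.ofNat_ne_zero, not_false_eq_true, zero_pow, dslope_same] at key
  rw [hder, norm_mul]
  norm_num
  exact key

/-- **Koebe quarter theorem**. -/
theorem norm_deriv_div_four_le_dist {f : ℂ → ℂ} (hf : DifferentiableOn ℂ f (ball 0 1))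
    (hinj : InjOn f (ball 0 1)) {w : ℂ} (hw : w ∉ f '' ball 0 1) :
    1 / 4 * ‖deriv f 0‖ ≤ dist (f 0) w := by
  have h0 : (0 : ℂ) ∈ ball (0 : ℂ) 1 := by simp
  have h01 : ball (0 : ℂ) 1 ∈ 𝓝 0 := isOpen_ball.mem_nhds h0
  set p := dslope f 0 with hp
  have hpd : DifferentiableOn ℂ p (ball 0 1) := (differentiableOn_dslope h01).2 hf
  have hfp : ∀ z, z * p z = f z - f 0 := by
    intro z
    simpa using sub_smul_dslope f 0 z
  have hp0 : p 0 = deriv f 0 := dslope_same f 0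
  have hpne : ∀ z ∈ ball (0 : ℂ) 1, p z ≠ 0 := by
    intro z hz hpz
    by_cases hz0 : z = 0
    · rw [hz0, hp0] at hpz
      exact (hf.analyticAt h01).deriv_ne_zero_of_injOn h01 hinj hpz
    · have := hfp z
      rw [hpz, mul_zero, eq_comm, sub_eq_zero] at this
      exact hz0 (hinj hz h0 this)
  have hwf : w - f 0 ≠ 0 := fun h ↦ hw ⟨0, h0, (sub_eq_zero.1 h).symm⟩
  have hp00 := hpne 0 h0
  set q₁ : ℂ → ℂ := fun z ↦ p 0 / p z with hq₁
  set c := p 0 / (w - f 0) with hc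
  set q₂ : ℂ → ℂ := fun z ↦ q₁ z - c * z with hq₂
  have hq₁d : DifferentiableOn ℂ q₁ (ball 0 1) := (differentiableOn_const _).div hpd hpne
  have hq₂d : DifferentiableOn ℂ q₂ (ball 0 1) := hq₁d.sub (by fun_prop)
  have hinj₁ : InjOn (fun z ↦ q₁ z / z) (ball 0 1 \ {0}) := by
    rintro x ⟨hx, hx0⟩ y ⟨hy, hy0⟩ hxy
    replace hx0 : x ≠ 0 := hx0
    replace hy0 : y ≠ 0 := hy0
    have hpx := hpne x hx
    have hpy := hpne y hy
    have h : x * p x = y * p y := by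
      simp only [hq₁] at hxy
      field_simp at hxy
      linear_combination -hxy
    rw [hfp, hfp] at h
    exact hinj hx hy (sub_left_injective h)
  have hinj₂ : InjOn (fun z ↦ q₂ z / z) (ball 0 1 \ {0}) := by
    have h : ∀ z : ℂ, z ≠ 0 → q₂ z / z = q₁ z / z - c := by
      intro z hz
      simp only [hq₂]
      field_simp
    intro x hx y hy hxy
    refine hinj₁ hx hy ?_
    simp only [h x hx.2, h y hy.2] at hxy
    exact sub_left_injective hxy
  have h₁ := norm_deriv_le_two_of_injOn_div hq₁d
    (fun z hz ↦ div_ne_zero hp00 (hpne z hz)) (div_self hp00) hinj₁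
  have h₂ := norm_deriv_le_two_of_injOn_div hq₂d (by
    intro z hz h
    have hpz := hpne z hz
    simp only [hq₂, hq₁, hc] at h
    field_simp at h
    have h' := (mul_eq_zero.1 (h.trans (mul_zero _))).resolve_left hp00
    refine hw ⟨z, hz, ?_⟩
    linear_combination -h' - hfp z) (by simp [hq₂, hq₁, div_self hp00]) hinj₂
  have hder : deriv q₂ 0 = deriv q₁ 0 - c := by
    have := (hq₁d.differentiableAt h01).hasDerivAt.sub ((hasDerivAt_id (0 : ℂ)).const_mul c)
    rw [mul_one] at this
    exact this.deriv
  have hc4 : ‖c‖ ≤ 4 := by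
    have : c = deriv q₁ 0 - deriv q₂ 0 := by rw [hder]; ring
    rw [this]
    linarith [norm_sub_le (deriv q₁ 0) (deriv q₂ 0)]
  rw [hc, norm_div, div_le_iff₀ (norm_pos_iff.2 hwf), hp0] at hc4
  rw [dist_comm, dist_eq_norm]
  linarith

/-- The Koebe distortion estimate at the origin. -/
theorem koebe_infDist_frontier_zero {f : ℂ → ℂ} (hf : DifferentiableOn ℂ f (ball 0 1))
    (hinj : InjOn f (ball 0 1)) :
    1 / 4 * ‖deriv f 0‖ ≤ infDist (f 0) (frontier (f '' ball 0 1)) ∧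
      infDist (f 0) (frontier (f '' ball 0 1)) ≤ ‖deriv f 0‖ := by
  have h0 : (0 : ℂ) ∈ ball (0 : ℂ) 1 := by simp
  have hopen : IsOpen (f '' ball 0 1) := by
    refine isOpen_iff_mem_nhds.2 ?_
    rintro _ ⟨z, hz, rfl⟩
    have hz' := isOpen_ball.mem_nhds hz
    have hfa := hf.analyticAt hz'
    rw [← hfa.hasStrictDerivAt.map_nhds_eq (hfa.deriv_ne_zero_of_injOn hz' hinj)]
    exact image_mem_map hz'
  have hne : (frontier (f '' ball 0 1)).Nonempty := by
    refine nonempty_frontier_iff.2 ⟨⟨f 0, mem_image_of_mem f h0⟩, fun h ↦ ?_⟩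
    have := le_norm_deriv_of_ball_subset_image (d := ‖deriv f 0‖ + 1) hf hinj (by simp [h])
    linarith
  constructor
  · refine (le_infDist hne).2 fun {w} hw ↦ norm_deriv_div_four_le_dist hf hinj ?_
    rw [hopen.frontier_eq] at hw
    exact hw.2
  · rcases le_or_gt (infDist (f 0) (frontier (f '' ball 0 1))) 0 with hd | hd
    · exact hd.trans (norm_nonneg _)
    refine le_norm_deriv_of_ball_subset_image hf hinj ?_
    refine (convex_ball _ _).isPreconnected.subset_of_closure_inter_subset hopen
      ⟨f 0, mem_ball_self hd, mem_image_of_mem f h0⟩ ?_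
    rintro w ⟨hwc, hwb⟩
    by_contra hwf
    refine ball_infDist_subset_compl hwb ?_
    rw [hopen.frontier_eq]
    exact ⟨hwc, hwf⟩

theorem one_add_conj_mul_ne_zero {z w : ℂ} (hz : ‖z‖ < 1) (hw : ‖w‖ < 1) : 1 + conj z * w ≠ 0 := by
  intro h
  have h1 : conj z * w = -1 := by linear_combination h
  have h2 : ‖z‖ * ‖w‖ = 1 := by simpa using congrArg norm h1
  nlinarith [norm_nonneg z, norm_nonneg w]

theorem norm_add_div_one_add_conj_mul_lt_one {z w : ℂ} (hz : ‖z‖ < 1) (hw : ‖w‖ < 1) :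
    ‖(w + z) / (1 + conj z * w)‖ < 1 := by
  have hne := one_add_conj_mul_ne_zero hz hw
  rw [norm_div, div_lt_one (norm_pos_iff.2 hne)]
  refine lt_of_pow_lt_pow_left₀ 2 (norm_nonneg _) ?_
  have hz2 : ‖z‖ ^ 2 < 1 := pow_lt_one₀ (norm_nonneg z) hz two_ne_zero
  have hw2 : ‖w‖ ^ 2 < 1 := pow_lt_one₀ (norm_nonneg w) hw two_ne_zero
  have h : ‖1 + conj z * w‖ ^ 2 - ‖w + z‖ ^ 2 = (1 - ‖z‖ ^ 2) * (1 - ‖w‖ ^ 2) := by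
    simp only [← normSq_eq_norm_sq, normSq_apply]
    simp
    ring
  nlinarith [mul_pos (sub_pos.2 hz2) (sub_pos.2 hw2)]

theorem add_div_one_add_conj_mul_leftInverse {z w : ℂ} (hz : ‖z‖ < 1) (hw : ‖w‖ < 1) :
    ((w + z) / (1 + conj z * w) + -z) / (1 + conj (-z) * ((w + z) / (1 + conj z * w))) = w := by
  have hne := one_add_conj_mul_ne_zero hz hw
  have hzz : 1 - conj z * z ≠ 0 := by
    have := one_add_conj_mul_ne_zero hz (w := -z) (by simpa using hz)
    simpa [sub_eq_add_neg] using this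
  rw [map_neg]
  generalize conj z = c at *
  have h1 : (w + z) / (1 + c * w) + -z = w * (1 - c * z) / (1 + c * w) := by
    rw [div_add' _ _ _ hne]
    ring
  have h2 : 1 + -c * ((w + z) / (1 + c * w)) = (1 - c * z) / (1 + c * w) := by
    rw [mul_div_assoc', add_comm, div_add' _ _ _ hne]
    ring
  rw [h1, h2, div_div_div_cancel_right₀ hne, mul_div_cancel_right₀ _ hzz]

theorem stmt_2 (f : ℂ → ℂ)
    (hf : DifferentiableOn ℂ f (Metric.ball 0 1))
    (hinj : Set.InjOn f (Metric.ball 0 1)) :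
    ∀ z ∈ Metric.ball (0:ℂ) 1,
      (1/4) * (1 - ‖z‖^2) * ‖deriv f z‖ ≤
        Metric.infDist (f z) (frontier (f '' Metric.ball 0 1)) ∧
      Metric.infDist (f z) (frontier (f '' Metric.ball 0 1)) ≤
        (1 - ‖z‖^2) * ‖deriv f z‖ := by
  intro z hz
  have hz1 : ‖z‖ < 1 := by simpa using hz
  set φ : ℂ → ℂ := fun w ↦ (w + z) / (1 + conj z * w) with hφ
  have hmaps : MapsTo φ (ball 0 1) (ball 0 1) := by
    intro w hw
    rw [mem_ball_zero_iff] at hw ⊢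
    exact norm_add_div_one_add_conj_mul_lt_one hz1 hw
  have hφinj : InjOn φ (ball 0 1) := by
    intro x hx y hy hxy
    rw [mem_ball_zero_iff] at hx hy
    rw [← add_div_one_add_conj_mul_leftInverse hz1 hx,
      ← add_div_one_add_conj_mul_leftInverse hz1 hy]
    simp only [hφ] at hxy
    rw [hxy]
  have hφim : φ '' ball 0 1 = ball 0 1 := by
    refine Subset.antisymm hmaps.image_subset fun w hw ↦ ?_
    rw [mem_ball_zero_iff] at hw
    have hz' : ‖-z‖ < 1 := by simpa using hz1
    refine ⟨(w + -z) / (1 + conj (-z) * w), ?_, ?_⟩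
    · simpa using norm_add_div_one_add_conj_mul_lt_one hz' hw
    · simpa [hφ] using add_div_one_add_conj_mul_leftInverse hz' hw
  have hφd : DifferentiableOn ℂ φ (ball 0 1) := by
    refine DifferentiableOn.div (by fun_prop) (by fun_prop) fun w hw ↦ ?_
    exact one_add_conj_mul_ne_zero hz1 (by simpa using hw)
  have hφ0 : φ 0 = z := by simp [hφ]
  have hφ' : HasDerivAt φ ((1 - ‖z‖ ^ 2 : ℝ) : ℂ) 0 := by
    have h := ((hasDerivAt_id (0 : ℂ)).add_const z).div
      (((hasDerivAt_id (0 : ℂ)).const_mul (conj z)).const_add 1) (by simp)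
    convert! h using 1
    simp [← normSq_eq_norm_sq, normSq_eq_conj_mul_self, mul_comm]
  have hfz : HasDerivAt f (deriv f z) (φ 0) := by
    rw [hφ0]
    exact (hf.differentiableAt (isOpen_ball.mem_nhds hz)).hasDerivAt
  have hder : ‖deriv (f ∘ φ) 0‖ = (1 - ‖z‖ ^ 2) * ‖deriv f z‖ := by
    have hpos : 0 ≤ 1 - ‖z‖ ^ 2 := sub_nonneg.2 (pow_le_one₀ (norm_nonneg z) hz1.le)
    rw [(hfz.comp 0 hφ').deriv, norm_mul, norm_real, Real.norm_of_nonneg hpos, mul_comm]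
  have key := koebe_infDist_frontier_zero (hf.comp hφd hmaps) (hinj.comp hφinj hmaps)
  rw [image_comp, hφim, hder, Function.comp_apply, hφ0] at key
  rwa [mul_assoc]
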